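/- arXiv:1309.6050 — 4 statements merged into one kernel-verified Lean document; each statement's English description precedes it below -/
import Mathlib

section
/- Let K be a field and let A be a finite-dimensional (possibly non-unital) associative K-algebra. If A is not nilpotent, then A contains a nontrivial idempotent, i.e., there exists a ∈ A with a ≠ 0 and a * a = a. -/
/-- The product of two subspaces of a (possibly non-unital) associative algebra:
the linear span of all products `a * b` with `a ∈ S` and `b ∈ T`. -/
def subMul {K A : Type*} [Field K] [NonUnitalRing A] [Module K A]
    (S T : Submodule K A) : Submodule K A :=
  Submodule.span K {x : A | ∃ a ∈ S, ∃ b ∈ T, x = a * b}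

/-- `subPow S n` is the linear span of all products of `n` elements of `S` (for `n ≥ 1`;
by convention `subPow S 0 = S`). -/
def subPow {K A : Type*} [Field K] [NonUnitalRing A] [Module K A]
    (S : Submodule K A) : ℕ → Submodule K A
  | 0 => S
  | 1 => S
  | (n + 2) => subMul S (subPow S (n + 1))

/-- A subspace of a (possibly non-unital) algebra is nilpotent (as an algebra) if the span
of its `n`-fold products vanishes for some `n ≥ 1`. -/
def IsNilpotentSub {K A : Type*} [Field K] [NonUnitalRing A] [Module K A]
    (S : Submodule K A) : Prop :=
  ∃ n, 1 ≤ n ∧ subPow S n = ⊥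

/-- A subspace of a (possibly non-unital) algebra is a two-sided ideal if it is closed under
multiplication by arbitrary elements of the algebra on both sides. -/
def IsTwoSidedIdealSub {K A : Type*} [Field K] [NonUnitalRing A] [Module K A]
    (I : Submodule K A) : Prop :=
  ∀ (a : A), ∀ x ∈ I, a * x ∈ I ∧ x * a ∈ I

open Polynomial in
/-- An integral element that is not nilpotent has a nonzero idempotent multiple. -/
theorem exists_isIdempotentElem_mul_of_not_isNilpotent {K U : Type*} [Field K] [Ring U]
    [Algebra K U] {x : U} (hint : IsIntegral K x) (hx : ¬ IsNilpotent x) :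
    ∃ z : U, IsIdempotentElem (z * x) ∧ z * x ≠ 0 := by
  obtain ⟨q, hpq, hq⟩ :=
    exists_eq_pow_rootMultiplicity_mul_and_not_dvd (minpoly K x) (minpoly.ne_zero hint) 0
  set k := (minpoly K x).rootMultiplicity 0
  simp only [map_zero, sub_zero] at hpq hq
  obtain ⟨u, v, huv⟩ : IsCoprime (X ^ (k + 1)) q :=
    (irreducible_X.coprime_iff_not_dvd.mpr hq).pow_left
  have hzero : aeval x (X ^ k * q) = 0 := hpq ▸ minpoly.aeval K x
  have hz : aeval x (u * X ^ k) * x = aeval x (u * X ^ (k + 1)) := by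
    simp [pow_succ, mul_assoc]
  refine ⟨aeval x (u * X ^ k), ?_, fun h => hx ⟨k, ?_⟩⟩
  · rw [hz, IsIdempotentElem, ← map_mul, ← sub_eq_zero, ← map_sub]
    have : u * X ^ (k + 1) * (u * X ^ (k + 1)) - u * X ^ (k + 1) =
        -(u * X * v) * (X ^ k * q) := by
      linear_combination u * X ^ (k + 1) * huv
    rw [this, map_mul, hzero, mul_zero]
  · rw [hz] at h
    have : (X ^ k : K[X]) = X ^ k * (u * X ^ (k + 1)) + v * (X ^ k * q) := by
      linear_combination -X ^ k * huv
    simpa only [map_add, map_mul, h, hzero, map_pow, aeval_X, mul_zero, add_zero] using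
      congrArg (aeval x) this

/-- An element all of whose left multiples are nilpotent lies in the Jacobson radical. -/
theorem mem_ringJacobson_of_forall_isNilpotent_mul {R : Type*} [Ring R] {x : R}
    (h : ∀ y, IsNilpotent (y * x)) : x ∈ Ring.jacobson R := by
  rw [← Ideal.jacobson_bot, Ideal.mem_jacobson_iff]
  intro y
  obtain ⟨z, hz⟩ := (h y).isUnit_add_one.exists_left_inv
  refine ⟨z, ?_⟩
  rw [Ideal.mem_bot, ← hz]
  noncomm_ring

/-- If the image of `S` under a multiplicative linear map lies in a left ideal `J`, then the image
of the span of the `(n + 1)`-fold products lies in `J ^ (n + 1)`. -/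
theorem map_mem_pow_of_mem_subPow {K A U : Type*} [Field K] [NonUnitalRing A] [Module K A]
    [Ring U] [Algebra K U] (f : A →ₙₐ[K] U) {J : Ideal U} {S : Submodule K A}
    (hS : ∀ a ∈ S, f a ∈ J) (n : ℕ) {a : A} (ha : a ∈ subPow S (n + 1)) :
    f a ∈ J ^ (n + 1) := by
  induction n generalizing a with
  | zero => rw [zero_add, Submodule.pow_one]; exact hS a ha
  | succ n ih =>
    change a ∈ Submodule.span K _ at ha
    induction ha using Submodule.span_induction with
    | mem _ h =>
      obtain ⟨b, hb, c, hc, rfl⟩ := h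
      rw [map_mul, Submodule.pow_succ' J n.succ_ne_zero]
      exact Ideal.mul_mem_mul (hS b hb) (ih hc)
    | zero => simp
    | add _ _ _ _ hx hy => rw [map_add]; exact add_mem hx hy
    | smul r _ _ hx => rw [map_smul]; exact Submodule.smul_of_tower_mem _ r hx

/-- A finite-dimensional non-nilpotent (possibly non-unital) associative
`K`-algebra contains a nontrivial idempotent. -/
theorem exists_nontrivial_idempotent_of_not_nilpotent
    (K A : Type*) [Field K] [NonUnitalRing A] [Module K A]
    [SMulCommClass K A A] [IsScalarTower K A A] [FiniteDimensional K A]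
    (h : ¬ IsNilpotentSub (⊤ : Submodule K A)) :
    ∃ a : A, a ≠ 0 ∧ a * a = a := by
  have : Module.Finite K (Unitization K A) :=
    Module.Finite.equiv (Unitization.linearEquiv K K A).symm
  have : IsArtinianRing (Unitization K A) := .of_finite K _
  by_contra! hidem
  have hnil (x : Unitization K A) (hx : x.fst = 0) : IsNilpotent x := by
    by_contra hx'
    obtain ⟨z, hz, hz0⟩ := exists_isIdempotentElem_mul_of_not_isNilpotent
      (Algebra.IsIntegral.isIntegral (R := K) x) hx'
    have hfst : (z * x).fst = 0 := by rw [Unitization.fst_mul, hx, mul_zero]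
    have heq : z * x = ((z * x).snd : A) := Unitization.ext (by simp [hfst]) rfl
    refine hidem (z * x).snd (fun h0 => hz0 (by rw [heq, h0, Unitization.inr_zero])) ?_
    apply Unitization.inr_injective (R := K)
    rw [Unitization.inr_mul, ← heq]
    exact hz
  obtain ⟨n, hn⟩ := IsSemiprimaryRing.isNilpotent (R := Unitization K A)
  refine h ⟨n + 1, n.succ_pos, (Submodule.eq_bot_iff _).mpr fun a ha => ?_⟩
  have hmem := map_mem_pow_of_mem_subPow (Unitization.inrNonUnitalAlgHom K A)
    (J := Ring.jacobson (Unitization K A))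
    (fun b _ => mem_ringJacobson_of_forall_isNilpotent_mul fun y => hnil _ (by simp)) n ha
  replace hmem := Ideal.pow_le_pow_right n.le_succ hmem
  rw [hn] at hmem
  exact Unitization.inr_injective (R := K) (by simpa using hmem)
end

section
/- Let A be a finite-dimensional unital associative algebra over ℂ with Jacobson radical J. Then there exists a unital subalgebra S of A such that S is a semisimple ring and A decomposes as the internal direct sum of vector spaces A = S ⊕ J; in particular S is isomorphic as a ℂ-algebra to A/J. -/
/-- Equivalences between idempotents lift along nil ideals: if the images of two idempotents
`e`, `e'` are equivalent through `p` and `q`, then `e` and `e'` are equivalent through lifts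
of `p` and `q`. -/
theorem exists_mul_eq_idempotent_of_ker_isNilpotent {R S : Type*} [Ring R] [Ring S] (f : R →+* S)
    (hf : Function.Surjective f) (h : ∀ x ∈ RingHom.ker f, IsNilpotent x) {e e' : R}
    (he : IsIdempotentElem e) (he' : IsIdempotentElem e') {p q : S}
    (hpq : p * q = f e) (hqp : q * p = f e') (hp : f e * p = p) (hq : f e' * q = q) :
    ∃ u v : R, u * v = e ∧ v * u = e' ∧ e * u = u ∧ e' * v = v ∧ f u = p ∧ f v = q := by
  obtain ⟨a, rfl⟩ := hf p
  obtain ⟨b, rfl⟩ := hf q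
  have hp' : f a * f e' = f a := by rw [← hqp, ← mul_assoc, hpq, hp]
  have hq' : f b * f e = f b := by rw [← hpq, ← mul_assoc, hqp, hq]
  set u := e * a * e' with hu
  set v := e' * b * e with hv
  have hfu : f u = f a := by simp [hu, hp, hp']
  have hfv : f v = f b := by simp [hv, hq, hq']
  have heu : e * u = u := by simp only [hu, ← mul_assoc, he.eq]
  have hue : u * e' = u := by simp only [hu, mul_assoc, he'.eq]
  have hev : e' * v = v := by simp only [hv, ← mul_assoc, he'.eq]
  have hve : v * e = v := by simp only [hv, mul_assoc, he.eq]
  have hn : f (e' - v * u) = 0 := by simp [hfu, hfv, hqp]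
  obtain ⟨w, hw⟩ := (h _ hn).isUnit_one_sub
  have hwe : (w : R) * e' = v * u := by
    rw [hw, sub_mul, sub_mul, one_mul, he'.eq, mul_assoc, hue]; abel
  have hew : e' * (w : R) = v * u := by
    rw [hw, mul_sub, mul_sub, mul_one, he'.eq, ← mul_assoc, hev]; abel
  have hcomm : e' * (↑w⁻¹ : R) = ↑w⁻¹ * e' :=
    (Commute.units_inv_right (hew.trans hwe.symm : Commute e' (w : R))).eq
  have hfw : f (↑w⁻¹ : R) = 1 := by
    have h1 : f (w : R) = 1 := by rw [hw, map_sub, hn, map_one, sub_zero]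
    rw [← mul_one (f _), ← h1, ← map_mul, Units.inv_mul, map_one, h1]
  have hvu : ↑w⁻¹ * v * u = e' := by rw [mul_assoc, ← hwe, Units.inv_mul_cancel_left]
  refine ⟨u, ↑w⁻¹ * v, ?_, hvu, heu, ?_, hfu, ?_⟩
  · have hz : e - u * (↑w⁻¹ * v) = 0 := by
      refine IsIdempotentElem.eq_zero_of_isNilpotent ?_ (h _ ?_)
      · have h1 : e * (u * (↑w⁻¹ * v)) = u * (↑w⁻¹ * v) := by rw [← mul_assoc, heu]
        have h2 : u * (↑w⁻¹ * v) * e = u * (↑w⁻¹ * v) := by simp only [mul_assoc, hve]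
        have h3 : u * (↑w⁻¹ * v) * (u * (↑w⁻¹ * v)) = u * (↑w⁻¹ * v) := by
          rw [mul_assoc, ← mul_assoc _ u, hvu, ← mul_assoc u e', hue]
        rw [IsIdempotentElem, mul_sub, sub_mul, sub_mul, he.eq, h1, h2, h3]; abel
      · rw [RingHom.mem_ker, map_sub, map_mul f u, map_mul f _ v, hfw, one_mul, hfu, hfv, hpq,
          sub_self]
    exact (sub_eq_zero.mp hz).symm
  · rw [← mul_assoc, hcomm, mul_assoc, hev]
  · rw [map_mul, hfw, one_mul, hfv]

/-- The diagonal matrix units of a product of matrix rings are complete orthogonal idempotents. -/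
theorem CompleteOrthogonalIdempotents.pi_single_matrix_single {ι : Type*} [Fintype ι]
    [DecidableEq ι] (n : ι → Type*) [∀ i, Fintype (n i)] [∀ i, DecidableEq (n i)]
    (R : Type*) [Semiring R] :
    CompleteOrthogonalIdempotents (fun x : Σ i, n i ↦
      (Pi.single x.1 (Matrix.single x.2 x.2 1) : Π i, Matrix (n i) (n i) R)) where
  idem x := by
    rw [IsIdempotentElem, ← Pi.single_mul, Matrix.single_mul_single_same, one_mul]
  ortho := by
    rintro ⟨i, a⟩ ⟨j, b⟩ hne
    dsimp only
    by_cases hij : i = j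
    · subst hij
      rw [← Pi.single_mul, Matrix.single_mul_single_of_ne _ _ _ _ (by rintro rfl; exact hne rfl),
        Pi.single_zero]
    · ext k : 1
      by_cases hk : k = i
      · subst hk; simp [Pi.single_eq_of_ne hij]
      · simp [Pi.single_eq_of_ne hk]
  complete := by
    rw [Fintype.sum_sigma]
    ext k : 1
    have (i : ι) : ∑ a : n i, (Pi.single i (Matrix.single a a 1) : Π i, Matrix (n i) (n i) R) =
        Pi.single i 1 := by
      rw [← Matrix.sum_single_one]
      exact (map_sum (AddMonoidHom.single (fun i ↦ Matrix (n i) (n i) R) i) _ _).symm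
    simp only [this]
    exact congr_fun (Finset.univ_sum_single (1 : Π i, Matrix (n i) (n i) R)) k

/-- A surjection with nil kernel from an algebra onto a finite product of matrix algebras
splits. -/
theorem AlgHom.exists_section_pi_matrix {K A ι : Type*} [CommRing K] [Ring A] [Algebra K A]
    [Fintype ι] [DecidableEq ι] {n : ι → Type*} [∀ i, Fintype (n i)] [∀ i, DecidableEq (n i)]
    [∀ i, Nonempty (n i)] (f : A →ₐ[K] Π i, Matrix (n i) (n i) K) (hf : Function.Surjective f)
    (h : ∀ x ∈ RingHom.ker f, IsNilpotent x) :
    ∃ g : (Π i, Matrix (n i) (n i) K) →ₐ[K] A, f.comp g = AlgHom.id K _ := by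
  obtain ⟨e, he, hfe⟩ := CompleteOrthogonalIdempotents.lift_of_isNilpotent_ker f.toRingHom h
    (.pi_single_matrix_single n K) (fun _ ↦ hf _)
  replace hfe (i) (a : n i) : f (e ⟨i, a⟩) = Pi.single i (Matrix.single a a 1) :=
    congr_fun hfe ⟨i, a⟩
  have key (i : ι) (a : n i) := exists_mul_eq_idempotent_of_ker_isNilpotent f.toRingHom hf h
    (he.idem ⟨i, a⟩) (he.idem ⟨i, Classical.arbitrary (n i)⟩)
    (p := Pi.single i (Matrix.single a (Classical.arbitrary (n i)) 1))
    (q := Pi.single i (Matrix.single (Classical.arbitrary (n i)) a 1))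
    (by simp [hfe, ← Pi.single_mul]) (by simp [hfe, ← Pi.single_mul])
    (by simp [hfe, ← Pi.single_mul]) (by simp [hfe, ← Pi.single_mul])
  choose u v huv hvu heu hev hfu hfv using key
  have hve (i) (a : n i) : v i a * e ⟨i, a⟩ = v i a := by
    rw [← huv, ← mul_assoc, hvu, hev]
  have hue (i) (a : n i) : u i a * e ⟨i, Classical.arbitrary (n i)⟩ = u i a := by
    rw [← hvu i a, ← mul_assoc, huv, heu]
  have hsame (i) (a b c : n i) : u i a * v i b * (u i b * v i c) = u i a * v i c := by
    rw [mul_assoc, ← mul_assoc (v i b), hvu, ← mul_assoc, hue]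
  have hzero {i j} {b : n i} {c : n j} (hne : (⟨i, b⟩ : Σ i, n i) ≠ ⟨j, c⟩) (a d) :
      u i a * v i b * (u j c * v j d) = 0 := by
    rw [← hve i b, ← heu j c]
    have := he.ortho hne
    simp only [mul_assoc]
    rw [← mul_assoc (e ⟨i, b⟩) (e ⟨j, c⟩), this]
    simp
  let g : (Π i, Matrix (n i) (n i) K) →ₗ[K] A :=
    ∑ i, ∑ a, ∑ b, ((Matrix.entryLinearMap K K a b).comp
      (LinearMap.proj (φ := fun i ↦ Matrix (n i) (n i) K) i)).smulRight (u i a * v i b)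
  have hg (x) : g x = ∑ i, ∑ a, ∑ b, x i a b • (u i a * v i b) := by
    simp [g, LinearMap.sum_apply]
  refine ⟨AlgHom.ofLinearMap g ?_ ?_, ?_⟩
  · rw [hg, ← he.complete, Fintype.sum_sigma]
    refine Finset.sum_congr rfl fun i _ ↦ Finset.sum_congr rfl fun a _ ↦ ?_
    simp [Matrix.one_apply, ite_smul, huv]
  · intro x y
    simp only [hg, Finset.sum_mul, Pi.mul_apply, Matrix.mul_apply, Finset.sum_smul]
    refine Finset.sum_congr rfl fun i _ ↦ Finset.sum_congr rfl fun a _ ↦ ?_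
    rw [Finset.sum_comm]
    refine Finset.sum_congr rfl fun b _ ↦ ?_
    simp only [Finset.mul_sum, smul_mul_smul_comm]
    symm
    refine (Finset.sum_eq_single i (fun j _ hj ↦ ?_) (by simp)).trans
      ((Finset.sum_eq_single b (fun c _ hc ↦ ?_) (by simp)).trans ?_)
    · refine Finset.sum_eq_zero fun c _ ↦ Finset.sum_eq_zero fun d _ ↦ ?_
      rw [hzero (fun h ↦ hj (congr_arg Sigma.fst h).symm), smul_zero]
    · refine Finset.sum_eq_zero fun d _ ↦ ?_
      rw [hzero (by simpa using hc.symm), smul_zero]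
    · simp only [hsame]
  · have hfuv (i) (a b : n i) : f (u i a * v i b) = Pi.single i (Matrix.single a b 1) := by
      rw [map_mul]
      refine (congr_arg₂ (· * ·) (hfu i a) (hfv i b)).trans ?_
      simp [← Pi.single_mul]
    ext x : 1
    simp only [AlgHom.comp_apply, AlgHom.ofLinearMap_apply, hg, map_sum, map_smul, hfuv,
      AlgHom.id_apply]
    conv_rhs => rw [← Finset.univ_sum_single x]
    refine Finset.sum_congr rfl fun i _ ↦ ?_
    conv_rhs => rw [Matrix.matrix_eq_sum_single (x i)]
    have (a b : n i) : x i a b • (Pi.single i (Matrix.single a b 1) : Π i, Matrix (n i) (n i) K) =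
        LinearMap.single K (fun i ↦ Matrix (n i) (n i) K) i (Matrix.single a b (x i a b)) := by
      simp [← Pi.single_smul]
    simp only [this, ← map_sum]
    rfl

/-- The range of a section of an algebra homomorphism is a complement of its kernel. -/
theorem AlgHom.isCompl_range_ker_of_section {K A B : Type*} [CommRing K] [Ring A] [Ring B]
    [Algebra K A] [Algebra K B] (f : A →ₐ[K] B) (g : B →ₐ[K] A) (h : f.comp g = AlgHom.id K B) :
    IsCompl (Subalgebra.toSubmodule g.range) ((RingHom.ker f).restrictScalars K) := by
  have hfg (x) : f (g x) = x := DFunLike.congr_fun h x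
  refine ⟨Submodule.disjoint_def.mpr ?_, codisjoint_iff_le_sup.mpr fun x _ ↦ ?_⟩
  · rintro _ ⟨x, rfl⟩ hx
    have hx : f (g x) = 0 := hx
    rw [hfg] at hx
    simp [hx]
  · refine Submodule.mem_sup.mpr ⟨g (f x), ⟨f x, rfl⟩, x - g (f x), ?_, by abel⟩
    change f (x - g (f x)) = 0
    rw [map_sub, hfg, sub_self]

/-- A subalgebra complementing the kernel of a surjective algebra homomorphism is isomorphic to
the codomain. -/
theorem Subalgebra.nonempty_algEquiv_of_isCompl_ker {K A B : Type*} [CommRing K] [Ring A] [Ring B]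
    [Algebra K A] [Algebra K B] (S : Subalgebra K A) (f : A →ₐ[K] B) (hf : Function.Surjective f)
    (h : IsCompl (Subalgebra.toSubmodule S) ((RingHom.ker f).restrictScalars K)) :
    Nonempty (S ≃ₐ[K] B) := by
  refine ⟨AlgEquiv.ofBijective (f.comp S.val) ⟨?_, fun b ↦ ?_⟩⟩
  · refine (injective_iff_map_eq_zero _).mpr fun x hx ↦ Subtype.ext ?_
    exact Submodule.disjoint_def.mp h.disjoint x x.2 hx
  · obtain ⟨a, rfl⟩ := hf b
    obtain ⟨s, hs, j, hj, rfl⟩ :=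
      Submodule.mem_sup.mp (h.sup_eq_top.ge (Submodule.mem_top (x := a)))
    have hj : f j = 0 := hj
    exact ⟨⟨s, hs⟩, by simp [hj]⟩

/-- Wedderburn–Malcev over ℂ: a finite-dimensional unital associative
ℂ-algebra `A` with Jacobson radical `J` has a unital subalgebra `S` which is a semisimple
ring and which is a vector-space complement of `J`, i.e. `A = S ⊕ J` internally; in
particular `S` is isomorphic as a ℂ-algebra to `A/J` (realized as any surjective ℂ-algebra
homomorphism image of `A` with kernel `J`). -/
theorem wedderburn_malcev_complex
    (A : Type*) [Ring A] [Algebra ℂ A] [FiniteDimensional ℂ A] :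
    ∃ S : Subalgebra ℂ A, IsSemisimpleRing S ∧
      IsCompl (Subalgebra.toSubmodule S) (((⊥ : Ideal A).jacobson).restrictScalars ℂ) ∧
      ∀ (B : Type*) [Ring B] [Algebra ℂ B] (f : A →ₐ[ℂ] B), Function.Surjective f →
        RingHom.ker f = (⊥ : Ideal A).jacobson → Nonempty (S ≃ₐ[ℂ] B) := by
  have := IsArtinianRing.of_finite ℂ A
  rw [Ideal.jacobson_bot]
  obtain ⟨m, d, _, ⟨φ⟩⟩ :=
    IsSemisimpleRing.exists_algEquiv_pi_matrix_of_isAlgClosed ℂ (A ⧸ Ring.jacobson A)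
  let f : A →ₐ[ℂ] Π i, Matrix (Fin (d i)) (Fin (d i)) ℂ :=
    φ.toAlgHom.comp (Ideal.Quotient.mkₐ ℂ (Ring.jacobson A))
  have hker : RingHom.ker f = Ring.jacobson A := by
    ext x
    change φ (Ideal.Quotient.mk _ x) = 0 ↔ _
    rw [EmbeddingLike.map_eq_zero_iff, Ideal.Quotient.eq_zero_iff_mem]
  have hnil : ∀ x ∈ RingHom.ker f, IsNilpotent x := by
    obtain ⟨k, hk⟩ := IsSemiprimaryRing.isNilpotent (R := A)
    intro x hx
    rw [hker] at hx
    exact ⟨k, by simpa [hk] using Ideal.pow_mem_pow hx k⟩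
  obtain ⟨g, hg⟩ := f.exists_section_pi_matrix
    (φ.surjective.comp Ideal.Quotient.mk_surjective) hnil
  have hcompl := f.isCompl_range_ker_of_section g hg
  rw [hker] at hcompl
  have hinj : Function.Injective g :=
    Function.LeftInverse.injective (g := f) fun x ↦ DFunLike.congr_fun hg x
  refine ⟨g.range, (AlgEquiv.ofInjective g hinj).toRingEquiv.isSemisimpleRing, hcompl,
    fun B _ _ f' hf' hker' ↦ ?_⟩
  rw [← hker'] at hcompl
  exact g.range.nonempty_algEquiv_of_isCompl_ker f' hf' hcompl
end

section
/- Let S = { L : Fin 3 → ℂ | L_k · L_k = L_k for all k, and L_k · L_l = 0 whenever k ≠ l }. The symmetric group on Fin 3 acts on S × S by simultaneous precomposition on both components: σ · (L, R) = (L ∘ σ, R ∘ σ). Then this action has exactly 5 orbits. (These 5 orbits correspond to the 5 equivalence classes of extensions of the semisimple algebra ℂ³ by the trivial 1-dimensional algebra.) -/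
/-- The solution set of the Maurer–Cartan equation for extensions of `ℂ³` by the trivial
1-dimensional algebra: families of scalars `L : Fin 3 → ℂ` with each `L k` idempotent and
`L k * L l = 0` for `k ≠ l`. -/
def MCSet : Set (Fin 3 → ℂ) :=
  {L | (∀ k, L k * L k = L k) ∧ ∀ k l, k ≠ l → L k * L l = 0}

/-- The family of scalars attached to an optional index: the zero family for `none`, and the
indicator of `i` for `some i`. -/
def indicatorFamily (o : Option (Fin 3)) (k : Fin 3) : ℂ :=
  if o = some k then 1 else 0

lemma indicatorFamily_mem_MCSet (o : Option (Fin 3)) : indicatorFamily o ∈ MCSet := by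
  refine ⟨fun k => by simp [indicatorFamily], fun k l hkl => ?_⟩
  simp only [indicatorFamily]
  split_ifs with hk hl <;> simp_all

lemma indicatorFamily_injective : Function.Injective indicatorFamily := by
  intro o o' h
  refine Option.ext fun k => ?_
  have hk := congrFun h k
  simp only [indicatorFamily] at hk
  split_ifs at hk <;> simp_all

lemma exists_indicatorFamily_eq {L : Fin 3 → ℂ} (hL : L ∈ MCSet) :
    ∃ o, indicatorFamily o = L := by
  obtain ⟨hidem, horth⟩ := hL
  by_cases h : ∃ i, L i ≠ 0
  · obtain ⟨i, hi⟩ := h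
    refine ⟨some i, funext fun k => ?_⟩
    by_cases hik : i = k
    · subst hik
      simpa [indicatorFamily] using (mul_left_cancel₀ hi ((hidem i).trans (mul_one _).symm)).symm
    · simpa [indicatorFamily, hik, hi, eq_comm] using horth i k hik
  · push Not at h
    exact ⟨none, funext fun k => by simp [indicatorFamily, h k]⟩

/-- Solutions of the Maurer–Cartan equation are the indicator families. -/
noncomputable def optionEquivMCSet : Option (Fin 3) ≃ MCSet :=
  Equiv.ofBijective (fun o => ⟨indicatorFamily o, indicatorFamily_mem_MCSet o⟩)
    ⟨fun _ _ h => indicatorFamily_injective (congrArg Subtype.val h), fun L =>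
      (exists_indicatorFamily_eq L.2).imp fun _ h => Subtype.ext h⟩

lemma coe_optionEquivMCSet (o : Option (Fin 3)) :
    (optionEquivMCSet o : Fin 3 → ℂ) = indicatorFamily o := rfl

lemma indicatorFamily_comp_perm (o : Option (Fin 3)) (σ : Equiv.Perm (Fin 3)) (k : Fin 3) :
    indicatorFamily (o.map σ) (σ k) = indicatorFamily o k := by
  cases o <;> simp [indicatorFamily]

lemma forall_indicatorFamily_eq_iff (o o' : Option (Fin 3)) (σ : Equiv.Perm (Fin 3)) :
    (∀ k, indicatorFamily o' k = indicatorFamily o (σ k)) ↔ o'.map σ = o := by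
  simp only [← indicatorFamily_comp_perm o' σ]
  rw [← indicatorFamily_injective.eq_iff, funext_iff]
  exact σ.forall_congr_right (q := fun k => indicatorFamily (o'.map σ) k = indicatorFamily o k)

/-- Two pairs of optional indices are related when a permutation of the indices carries one to
the other. -/
def PermRel (p q : Option (Fin 3) × Option (Fin 3)) : Prop :=
  ∃ σ : Equiv.Perm (Fin 3), q.1.map σ = p.1 ∧ q.2.map σ = p.2

instance (p q : Option (Fin 3) × Option (Fin 3)) : Decidable (PermRel p q) :=
  inferInstanceAs (Decidable (∃ σ : Equiv.Perm (Fin 3), q.1.map σ = p.1 ∧ q.2.map σ = p.2))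

/-- The orbit type of a pair of optional indices. -/
def orbitType : Option (Fin 3) × Option (Fin 3) → Fin 5
  | (none, none) => 0
  | (some _, none) => 1
  | (none, some _) => 2
  | (some i, some j) => if i = j then 3 else 4

/-- A pair of optional indices of each orbit type. -/
def orbitRepr : Fin 5 → Option (Fin 3) × Option (Fin 3) :=
  ![(none, none), (some 0, none), (none, some 0), (some 0, some 0), (some 0, some 1)]

lemma orbitType_eq_of_permRel {p q : Option (Fin 3) × Option (Fin 3)} (h : PermRel p q) :
    orbitType p = orbitType q := by
  obtain ⟨_ | i, _ | j⟩ := q <;> obtain ⟨σ, h₁, h₂⟩ := h <;> obtain ⟨p₁, p₂⟩ := p <;>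
    subst h₁ h₂ <;> simp [orbitType]

lemma orbitType_orbitRepr : ∀ i, orbitType (orbitRepr i) = i := by decide

lemma permRel_orbitRepr_orbitType : ∀ p, PermRel (orbitRepr (orbitType p)) p := by decide

/-- The classes of `PermRel` are classified by their orbit type. -/
def quotPermRelEquiv : Quot PermRel ≃ Fin 5 where
  toFun := Quot.lift orbitType fun _ _ => orbitType_eq_of_permRel
  invFun i := Quot.mk _ (orbitRepr i)
  left_inv := by
    rintro ⟨p⟩
    exact Quot.sound (permRel_orbitRepr_orbitType p)
  right_inv := orbitType_orbitRepr

/-- the action of the symmetric group `Σ₃` on `MCSet × MCSet` by simultaneous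
precomposition, `σ · (L, R) = (L ∘ σ, R ∘ σ)`, has exactly 5 orbits (corresponding to the
5 equivalence classes of extensions of `ℂ³` by the trivial 1-dimensional algebra). -/
theorem card_orbits_extensions_C3_by_trivial :
    Nat.card (Quot (fun p q : MCSet × MCSet =>
      ∃ σ : Equiv.Perm (Fin 3),
        (∀ k, (q.1 : Fin 3 → ℂ) k = (p.1 : Fin 3 → ℂ) (σ k)) ∧
        (∀ k, (q.2 : Fin 3 → ℂ) k = (p.2 : Fin 3 → ℂ) (σ k)))) = 5 := by
  rw [← Nat.card_fin 5]
  refine Nat.card_congr (Equiv.trans (Equiv.symm ?_) quotPermRelEquiv)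
  refine Quot.congr (optionEquivMCSet.prodCongr optionEquivMCSet) fun p q => ?_
  simp only [PermRel, Equiv.prodCongr_apply, Prod.map_fst, Prod.map_snd, coe_optionEquivMCSet,
    forall_indicatorFamily_eq_iff]
end

section
/- Let A be a 2-dimensional (possibly non-unital) associative ℂ-algebra which is nilpotent. Then either the multiplication of A is identically zero, or A is isomorphic as a ℂ-algebra to the algebra with basis e₁, e₂ whose only nonzero product of basis elements is e₂e₂ = e₁. -/
/-- The multiplication of the unique nontrivial nilpotent 2-dimensional complex algebra
`d₆ = ψ₁²²`: on the basis `e₁ = 0`-th, `e₂ = 1`-st coordinate, the only nonzero product of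
basis elements is `e₂ e₂ = e₁`. -/
def mulNil2 (x y : Fin 2 → ℂ) : Fin 2 → ℂ :=
  fun i => if i = 0 then x 1 * y 1 else 0

section Nilpotent

variable {K A : Type*} [Field K] [NonUnitalRing A] [Module K A]

theorem mul_mem_subMul {S T : Submodule K A} {a b : A} (ha : a ∈ S) (hb : b ∈ T) :
    a * b ∈ subMul S T :=
  Submodule.subset_span ⟨a, ha, b, hb, rfl⟩

theorem subMul_mono {S S' T T' : Submodule K A} (hS : S ≤ S') (hT : T ≤ T') :
    subMul S T ≤ subMul S' T' := by
  refine Submodule.span_mono ?_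
  rintro x ⟨a, ha, b, hb, rfl⟩
  exact ⟨a, hS ha, b, hT hb, rfl⟩

/-- A nonzero subspace of a nilpotent algebra is not contained in its multiples. -/
theorem eq_bot_of_le_subMul_top (hnil : IsNilpotentSub (⊤ : Submodule K A))
    {S : Submodule K A} (hS : S ≤ subMul ⊤ S) : S = ⊥ := by
  obtain ⟨n, -, hn⟩ := hnil
  have key : ∀ m, S ≤ subPow (⊤ : Submodule K A) (m + 1) := by
    intro m
    induction m with
    | zero => exact le_top
    | succ m ih => exact hS.trans (subMul_mono le_rfl ih)
  cases n with
  | zero => exact le_bot_iff.1 (hn ▸ le_top)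
  | succ m => exact le_bot_iff.1 (hn ▸ key m)

/-- In a nilpotent algebra of dimension two all triple products vanish. -/
theorem mul_mul_eq_zero_of_finrank_eq_two (hdim : Module.finrank K A = 2)
    (hnil : IsNilpotentSub (⊤ : Submodule K A)) (x y z : A) : x * (y * z) = 0 := by
  have : FiniteDimensional K A := FiniteDimensional.of_finrank_pos (by omega)
  set B : Submodule K A := subMul ⊤ ⊤ with hB
  set C : Submodule K A := subMul ⊤ B with hC
  have hCB : C ≤ B := subMul_mono le_rfl le_top
  have hxyz : x * (y * z) ∈ C := mul_mem_subMul trivial (mul_mem_subMul trivial trivial)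
  suffices C = ⊥ by simpa [this] using hxyz
  by_contra hC0
  have hB_top : B ≠ ⊤ := by
    intro h
    have htop := eq_bot_of_le_subMul_top hnil (S := ⊤) h.ge
    rw [← finrank_top K A, htop, finrank_bot] at hdim
    omega
  have hB_lt : Module.finrank K B < 2 := hdim ▸ Submodule.finrank_lt hB_top
  have hC_pos : 1 ≤ Module.finrank K C := Submodule.one_le_finrank_iff.2 hC0
  have hCB_eq : C = B := Submodule.eq_of_le_of_finrank_le hCB (by omega)
  exact hC0 (hCB_eq.trans (eq_bot_of_le_subMul_top hnil hCB_eq.ge))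

variable [SMulCommClass K A A]

/-- An algebra of dimension two with vanishing triple products and vanishing squares has zero
multiplication. -/
theorem mul_eq_zero_of_forall_mul_self_eq_zero [IsScalarTower K A A]
    (hdim : Module.finrank K A = 2)
    (h3 : ∀ x y z : A, x * (y * z) = 0) (hsq : ∀ x : A, x * x = 0) (x y : A) :
    x * y = 0 := by
  by_contra hxy
  have hx : x ≠ 0 := by rintro rfl; simp at hxy
  have hli : LinearIndependent K ![x, y] := by
    rw [LinearIndependent.pair_iff' hx]
    rintro a rfl
    exact hxy (by rw [mul_smul_comm, hsq, smul_zero])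
  have hspan := hli.span_eq_top_of_card_eq_finrank (by simp [hdim])
  have hmem : x * y ∈ Submodule.span K (Set.range ![x, y]) := hspan ▸ trivial
  rw [Matrix.range_cons_cons_empty, Submodule.mem_span_pair] at hmem
  obtain ⟨a, b, hab⟩ := hmem
  have hl := congrArg (x * ·) hab
  have hr := congrArg (· * y) hab
  simp only [mul_add, add_mul, mul_smul_comm, smul_mul_assoc, hsq, h3, mul_assoc, smul_zero,
    zero_add, add_zero, mul_zero, smul_eq_zero, hxy, or_false] at hl hr
  exact hxy (by rw [← hab, hl, hr, zero_smul, zero_smul, add_zero])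

/-- If triple products vanish, an element with nonzero square is independent of its square. -/
theorem linearIndependent_mul_self_pair (h3 : ∀ x y z : A, x * (y * z) = 0) {x : A}
    (hx : x * x ≠ 0) : LinearIndependent K ![x * x, x] := by
  rw [LinearIndependent.pair_iff' hx]
  intro a ha
  have h := congrArg (x * ·) ha
  simp only [mul_smul_comm, h3, smul_zero] at h
  exact hx h.symm

end Nilpotent

/-- a 2-dimensional nilpotent (possibly non-unital) associative ℂ-algebra
either has identically zero multiplication or is isomorphic to the algebra with
`e₂ e₂ = e₁` as the only nonzero product of basis elements. -/
theorem two_dimensional_nilpotent_classification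
    (A : Type*) [NonUnitalRing A] [Module ℂ A]
    [SMulCommClass ℂ A A] [IsScalarTower ℂ A A]
    (hdim : Module.finrank ℂ A = 2)
    (hnil : IsNilpotentSub (⊤ : Submodule ℂ A)) :
    (∀ x y : A, x * y = 0) ∨
      ∃ f : A ≃ₗ[ℂ] (Fin 2 → ℂ), ∀ x y : A, f (x * y) = mulNil2 (f x) (f y) := by
  have h3 := mul_mul_eq_zero_of_finrank_eq_two hdim hnil
  by_cases hsq : ∀ x : A, x * x = 0
  · exact Or.inl (mul_eq_zero_of_forall_mul_self_eq_zero (K := ℂ) hdim h3 hsq)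
  push Not at hsq
  obtain ⟨x, hx⟩ := hsq
  right
  let b := basisOfLinearIndependentOfCardEqFinrank
    (linearIndependent_mul_self_pair (K := ℂ) h3 hx) (by simp [hdim])
  have hb0 : b 0 = x * x := by simp [b]
  have hb1 : b 1 = x := by simp [b]
  have hrepr (u : A) : u = b.equivFun u 0 • (x * x) + b.equivFun u 1 • x := by
    conv_lhs => rw [← b.sum_equivFun u, Fin.sum_univ_two, hb0, hb1]
  refine ⟨b.equivFun, fun u v => ?_⟩
  apply b.equivFun.symm.injective
  rw [LinearEquiv.symm_apply_apply, b.equivFun_symm_apply, Fin.sum_univ_two, hb0, hb1]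
  conv_lhs => rw [hrepr u, hrepr v]
  simp only [mulNil2, mul_add, add_mul, mul_smul_comm, smul_mul_assoc, mul_assoc, h3, smul_zero,
    zero_add, add_zero, if_true, one_ne_zero, if_false, zero_smul, smul_smul]
  rw [mul_comm]
end
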